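/- Let Ω ⊂ ℝⁿ be a bounded open set with C² boundary whose second fundamental form with respect to the outward normal is positive definite (strictly convex), and let q be a convex function, C¹ on the closure of Ω. Let φ₀ be a first Dirichlet eigenfunction of L_q = Δ − q on Ω with eigenvalue λ₀. Then −log φ₀ is convex on Ω; equivalently, (∇log φ₀(y) − ∇log φ₀(x)) · (y − x) ≤ 0 for all x, y ∈ Ω. -/

import Mathlib

open scoped RealInnerProductSpace
open Set MeasureTheory

noncomputable def lap {n : ℕ} (f : EuclideanSpace ℝ (Fin n) → ℝ) (x : EuclideanSpace ℝ (Fin n)) : ℝ :=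
  ∑ i, fderiv ℝ (fun y => fderiv ℝ f y (EuclideanSpace.single i 1)) x
      (EuclideanSpace.single i 1)

open Filter Topology

theorem second_test {f f' : ℝ → ℝ} {s : ℝ} (h1 : ∀ᶠ t in 𝓝 (0:ℝ), HasDerivAt f (f' t) t)
    (h2 : HasDerivAt f' s 0) (hm : IsLocalMax f 0) : f' 0 = 0 ∧ s ≤ 0 := by
  have h0 : f' 0 = 0 := hm.hasDerivAt_eq_zero h1.self_of_nhds
  refine ⟨h0, ?_⟩
  by_contra! hs
  have hd : deriv f =ᶠ[𝓝 0] f' := h1.mono fun t ht => ht.deriv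
  have hdd : deriv (deriv f) 0 = s := by rw [hd.deriv_eq]; exact h2.deriv
  have hmin := isLocalMin_of_deriv_deriv_pos (f := f) (x₀ := 0) (by rw [hdd]; exact hs)
    (by rw [hd.self_of_nhds, h0]) h1.self_of_nhds.continuousAt
  have hc : f =ᶠ[𝓝 0] fun _ => f 0 := by
    filter_upwards [hmin, hm] with t a b using le_antisymm b a
  have : deriv f =ᶠ[𝓝 0] deriv (fun _ => f 0) := hc.deriv
  have h3 := this.deriv_eq
  rw [hdd] at h3
  simp at h3
  linarith

theorem taylor2 {f f' f'' : ℝ → ℝ}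
    (h1 : ∀ t ∈ Icc (0:ℝ) 1, HasDerivWithinAt f (f' t) (Icc 0 1) t)
    (h2 : ∀ t ∈ Icc (0:ℝ) 1, HasDerivWithinAt f' (f'' t) (Icc 0 1) t) :
    ∃ t ∈ Icc (0:ℝ) 1, f 1 = f 0 + f' 0 + f'' t / 2 := by
  set c := f 1 - f 0 - f' 0 with hc
  let g : ℝ → ℝ := fun s => f s - f 0 - f' 0 * s - c * s ^ 2
  let g' : ℝ → ℝ := fun s => f' s - f' 0 - c * (2 * s)
  have hg : ∀ t ∈ Icc (0:ℝ) 1, HasDerivWithinAt g (g' t) (Icc 0 1) t := by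
    intro t ht
    have := (((h1 t ht).sub_const (f 0)).sub ((hasDerivWithinAt_id t _).const_mul (f' 0))).sub
      (((hasDerivWithinAt_id t (Icc (0:ℝ) 1)).pow 2).const_mul c)
    refine this.congr_deriv ?_
    simp [g']
  have hg' : ∀ t ∈ Icc (0:ℝ) 1, HasDerivWithinAt g' (f'' t - 2 * c) (Icc 0 1) t := by
    intro t ht
    have := (((h2 t ht).sub_const (f' 0))).sub
      (((hasDerivWithinAt_id t (Icc (0:ℝ) 1)).const_mul 2).const_mul c)
    refine this.congr_deriv ?_
    simp; ring
  obtain ⟨a, ha, ha'⟩ := exists_hasDerivAt_eq_zero (f := g) (f' := g') (zero_lt_one)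
    (fun t ht => (hg t ht).continuousWithinAt) (by simp [g, hc])
    (fun t ht => (hg t (Ioo_subset_Icc_self ht)).hasDerivAt (Icc_mem_nhds ht.1 ht.2))
  have hsub : Icc 0 a ⊆ Icc (0:ℝ) 1 := Icc_subset_Icc_right ha.2.le
  obtain ⟨b, hb, hb'⟩ := exists_hasDerivAt_eq_zero (f := g') (f' := fun t => f'' t - 2 * c) ha.1
    (fun t ht => ((hg' t (hsub ht)).mono hsub).continuousWithinAt) (by rw [ha']; simp [g'])
    (fun t ht => ((hg' t (hsub (Ioo_subset_Icc_self ht))).mono hsub).hasDerivAt (Icc_mem_nhds ht.1 ht.2))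
  refine ⟨b, hsub (Ioo_subset_Icc_self hb), ?_⟩
  linarith

/-- second directional derivative -/
noncomputable def dd {E : Type*} [NormedAddCommGroup E] [NormedSpace ℝ E] (f : E → ℝ) (x w : E) : ℝ :=
  fderiv ℝ (fun y => fderiv ℝ f y w) x w

section
variable {E : Type*} [NormedAddCommGroup E] [NormedSpace ℝ E]

theorem line1 {u : E → ℝ} {Ω : Set E} (hΩ : IsOpen Ω) (hu : ContDiffOn ℝ 2 u Ω) (x w : E) (t : ℝ)
    (h : x + t • w ∈ Ω) : HasDerivAt (fun t : ℝ => u (x + t • w)) (fderiv ℝ u (x + t • w) w) t := by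
  have h1 : HasFDerivAt u (fderiv ℝ u (x + t • w)) (x + t • w) :=
    ((hu.contDiffAt (hΩ.mem_nhds h)).differentiableAt (by norm_num)).hasFDerivAt
  have h2 : HasDerivAt (fun t : ℝ => x + t • w) w t := by
    simpa using ((hasDerivAt_id t).smul_const w).const_add x
  exact h1.comp_hasDerivAt t h2

theorem diff2 {u : E → ℝ} {Ω : Set E} (hΩ : IsOpen Ω) (hu : ContDiffOn ℝ 2 u Ω) {x : E} (w : E)
    (h : x ∈ Ω) : DifferentiableAt ℝ (fun y => fderiv ℝ u y w) x := by
  have h1 : ContDiffAt ℝ 1 (fderiv ℝ u) x :=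
    (hu.contDiffAt (hΩ.mem_nhds h)).fderiv_right (by norm_num)
  exact (h1.differentiableAt (by norm_num)).clm_apply (differentiableAt_const w)

theorem line2 {u : E → ℝ} {Ω : Set E} (hΩ : IsOpen Ω) (hu : ContDiffOn ℝ 2 u Ω) (x w : E) (t : ℝ)
    (h : x + t • w ∈ Ω) :
    HasDerivAt (fun t : ℝ => fderiv ℝ u (x + t • w) w) (dd u (x + t • w) w) t := by
  have h2 : HasDerivAt (fun t : ℝ => x + t • w) w t := by
    simpa using ((hasDerivAt_id t).smul_const w).const_add x
  exact (diff2 hΩ hu w h).hasFDerivAt.comp_hasDerivAt (f := fun t : ℝ => x + t • w) t h2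

theorem line_ev {Ω : Set E} (hΩ : IsOpen Ω) {x : E} (hx : x ∈ Ω) (w : E) :
    ∀ᶠ t in 𝓝 (0:ℝ), x + t • w ∈ Ω := by
  have : ContinuousAt (fun t : ℝ => x + t • w) 0 := by fun_prop
  exact this.eventually_mem (hΩ.mem_nhds (by simpa using hx))

/-- log derivatives -/
theorem log_fderiv {φ : E → ℝ} {Ω : Set E} (hΩ : IsOpen Ω) (hu : ContDiffOn ℝ 2 φ Ω)
    (hp : ∀ x ∈ Ω, 0 < φ x) {x : E} (hx : x ∈ Ω) (w : E) :
    fderiv ℝ (fun z => Real.log (φ z)) x w = fderiv ℝ φ x w / φ x := by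
  have h1 : HasFDerivAt φ (fderiv ℝ φ x) x :=
    ((hu.contDiffAt (hΩ.mem_nhds hx)).differentiableAt (by norm_num)).hasFDerivAt
  rw [(h1.log (hp x hx).ne').fderiv]
  simp; ring

theorem log_dd {φ : E → ℝ} {Ω : Set E} (hΩ : IsOpen Ω) (hu : ContDiffOn ℝ 2 φ Ω)
    (hp : ∀ x ∈ Ω, 0 < φ x) {x : E} (hx : x ∈ Ω) (w : E) :
    dd (fun z => Real.log (φ z)) x w = dd φ x w / φ x - (fderiv ℝ φ x w / φ x) ^ 2 := by
  have h1 : HasFDerivAt φ (fderiv ℝ φ x) x :=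
    ((hu.contDiffAt (hΩ.mem_nhds hx)).differentiableAt (by norm_num)).hasFDerivAt
  have he : (fun y => fderiv ℝ (fun z => Real.log (φ z)) y w) =ᶠ[𝓝 x]
      fun y => fderiv ℝ φ y w / φ y := by
    filter_upwards [hΩ.mem_nhds hx] with y hy using log_fderiv hΩ hu hp hy w
  have hne := (hp x hx).ne'
  unfold dd
  have h2 := ((diff2 hΩ hu w hx).hasFDerivAt.mul
    ((hasDerivAt_inv hne).comp_hasFDerivAt x h1)).congr_of_eventuallyEq
    (Eventually.of_forall fun y => div_eq_mul_inv (fderiv ℝ φ y w) (φ y))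
  rw [he.fderiv_eq, h2.fderiv]
  simp
  field_simp
  ring

theorem log_contDiffOn {φ : E → ℝ} {Ω : Set E} (hu : ContDiffOn ℝ 2 φ Ω)
    (hp : ∀ x ∈ Ω, 0 < φ x) : ContDiffOn ℝ 2 (fun z => Real.log (φ z)) Ω :=
  hu.log (fun x hx => (hp x hx).ne')

theorem mid_of_dd {u : E → ℝ} {Ω : Set E} (hΩ : IsOpen Ω) (hu : ContDiffOn ℝ 2 u Ω)
    (hc : Convex ℝ Ω) (hd : ∀ x ∈ Ω, ∀ w, dd u x w ≤ 0) {x y : E} (hx : x ∈ Ω) (hy : y ∈ Ω) :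
    u x + u y ≤ 2 * u ((1/2:ℝ) • (x + y)) := by
  set z := (1/2:ℝ) • (x + y) with hz
  set d := (1/2:ℝ) • (y - x) with hd'
  have e1 : z + d = y := by simp only [hz, hd']; module
  have e2 : z + -d = x := by simp only [hz, hd']; module
  have hzΩ : z ∈ Ω := by
    have := hc hx hy (show (0:ℝ) ≤ 1/2 by norm_num) (show (0:ℝ) ≤ 1/2 by norm_num) (by norm_num)
    rwa [hz, smul_add]
  have m1 : ∀ t ∈ Icc (0:ℝ) 1, z + t • d ∈ Ω := fun t ht =>
    hc.add_smul_mem hzΩ (by rw [e1]; exact hy) ht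
  have m2 : ∀ t ∈ Icc (0:ℝ) 1, z + t • (-d) ∈ Ω := fun t ht =>
    hc.add_smul_mem hzΩ (by rw [e2]; exact hx) ht
  obtain ⟨t, ht, h⟩ := taylor2 (f := fun t => u (z + t • d) + u (z + t • (-d)))
    (f' := fun t => fderiv ℝ u (z + t • d) d + fderiv ℝ u (z + t • (-d)) (-d))
    (f'' := fun t => dd u (z + t • d) d + dd u (z + t • (-d)) (-d))
    (fun t ht => ((line1 hΩ hu z d t (m1 t ht)).add
      (line1 hΩ hu z (-d) t (m2 t ht))).hasDerivWithinAt)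
    (fun t ht => ((line2 hΩ hu z d t (m1 t ht)).add
      (line2 hΩ hu z (-d) t (m2 t ht))).hasDerivWithinAt)
  have a1 := hd _ (m1 t ht) d
  have a2 := hd _ (m2 t ht) (-d)
  simp only [one_smul, zero_smul, add_zero, e1, e2, map_neg] at h
  linarith

/-- midpoint concavity gives dd ≤ 0 -/
theorem dd_of_mid {u : E → ℝ} {Ω : Set E} (hΩ : IsOpen Ω) (hu : ContDiffOn ℝ 2 u Ω)
    (hm : ∀ x ∈ Ω, ∀ y ∈ Ω, u x + u y ≤ 2 * u ((1/2:ℝ) • (x + y))) {x : E} (hx : x ∈ Ω) (w : E) :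
    dd u x w ≤ 0 := by
  have ev1 := line_ev hΩ hx w
  have ev2 := line_ev hΩ hx (-w)
  have := second_test (f := fun t => u (x + t • w) + u (x + t • (-w)))
    (f' := fun t => fderiv ℝ u (x + t • w) w + fderiv ℝ u (x + t • (-w)) (-w))
    (by filter_upwards [ev1, ev2] with t h1 h2
        exact (line1 hΩ hu x w t h1).add (line1 hΩ hu x (-w) t h2))
    ((line2 hΩ hu x w 0 (by simpa using hx)).add (line2 hΩ hu x (-w) 0 (by simpa using hx)))
    (by filter_upwards [ev1, ev2] with t h1 h2
        have := hm _ h1 _ h2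
        have e : (1/2:ℝ) • (x + t • w + (x + t • (-w))) = x := by module
        rw [e] at this
        simp only [zero_smul, add_zero]
        linarith)
  have h2 := this.2
  have e : dd u x (-w) = dd u x w := by
    unfold dd
    have : (fun y => fderiv ℝ u y (-w)) = fun y => - fderiv ℝ u y w := by
      funext y; simp
    rw [this, fderiv_fun_neg]; simp
  simp only [zero_smul, add_zero, e] at h2
  linarith

/-- dd ≤ 0 gives gradient monotonicity -/
theorem mono_of_dd {u : E → ℝ} {Ω : Set E} (hΩ : IsOpen Ω) (hu : ContDiffOn ℝ 2 u Ω)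
    (hc : Convex ℝ Ω) (hd : ∀ x ∈ Ω, ∀ w, dd u x w ≤ 0) {x y : E} (hx : x ∈ Ω) (hy : y ∈ Ω) :
    fderiv ℝ u y (y - x) ≤ fderiv ℝ u x (y - x) := by
  have m1 : ∀ t ∈ Icc (0:ℝ) 1, x + t • (y - x) ∈ Ω := fun t ht =>
    hc.add_smul_mem hx (by simpa using hy) ht
  have hder := fun t ht => line2 hΩ hu x (y - x) t (m1 t ht)
  obtain ⟨c, hc, h⟩ := exists_hasDerivAt_eq_slope _ _ (zero_lt_one' ℝ)
    (fun t ht => (hder t ht).continuousAt.continuousWithinAt)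
    (fun t ht => hder t (Ioo_subset_Icc_self ht))
  have := hd _ (m1 c (Ioo_subset_Icc_self hc)) (y - x)
  rw [h] at this
  simp only [one_smul, zero_smul, add_zero, sub_zero, div_one, add_sub_cancel] at this
  linarith

end

theorem interior_max {n : ℕ} {Ω : Set (EuclideanSpace ℝ (Fin n))} (hΩ : IsOpen Ω)
    (hc : Convex ℝ Ω) {u q : EuclideanSpace ℝ (Fin n) → ℝ} (hu : ContDiffOn ℝ 2 u Ω)
    {lam R m : ℝ}
    (hq : ∀ x ∈ Ω, ∀ y ∈ Ω, 2 * q ((1/2:ℝ) • (x + y)) ≤ q x + q y)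
    (heq : ∀ x ∈ Ω, ∑ i, dd u x (EuclideanSpace.single i 1) =
      q x - lam - ∑ i, (fderiv ℝ u x (EuclideanSpace.single i 1)) ^ 2)
    (i0 : Fin n) (hR : ∀ x ∈ Ω, |x i0| ≤ R)
    {T : Set (EuclideanSpace ℝ (Fin n) × EuclideanSpace ℝ (Fin n))} (hT : IsCompact T)
    (hTΩ : T ⊆ Ω ×ˢ Ω) (hm : 0 < m) {x1 y1 : EuclideanSpace ℝ (Fin n)} (hx1 : x1 ∈ Ω)
    (hy1 : y1 ∈ Ω) (h1 : m ≤ u x1 + u y1 - 2 * u ((1/2:ℝ) • (x1 + y1)))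
    (hout : ∀ x ∈ Ω, ∀ y ∈ Ω, (x, y) ∉ T → u x + u y - 2 * u ((1/2:ℝ) • (x + y)) ≤ m / 2) :
    False := by
  have hz : ∀ x ∈ Ω, ∀ y ∈ Ω, (1/2:ℝ) • (x + y) ∈ Ω := by
    intro x hx y hy
    have := hc hx hy (show (0:ℝ) ≤ 1/2 by norm_num) (show (0:ℝ) ≤ 1/2 by norm_num) (by norm_num)
    rwa [smul_add]
  have hucont : ContinuousOn u Ω := hu.continuousOn
  have hzc : ContinuousOn (fun p : EuclideanSpace ℝ (Fin n) × EuclideanSpace ℝ (Fin n) =>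
      (1/2:ℝ) • (p.1 + p.2)) T := by fun_prop
  have hzm : MapsTo (fun p : EuclideanSpace ℝ (Fin n) × EuclideanSpace ℝ (Fin n) =>
      (1/2:ℝ) • (p.1 + p.2)) T Ω := fun p hp => hz _ (hTΩ hp).1 _ (hTΩ hp).2
  have hdc : ContinuousOn (fun x => fderiv ℝ u x (EuclideanSpace.single i0 1)) Ω :=
    fun x hx => (diff2 hΩ hu _ hx).continuousAt.continuousWithinAt
  obtain ⟨C, hC⟩ := hT.exists_bound_of_continuousOn (hdc.comp hzc hzm)
  set K := max C 0 + 1 with hK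
  have hK1 : 1 ≤ K := by simp [hK]
  have hCK : C + 1 ≤ K := by simp [hK]
  set ε := min (m / 2) (1 / K) * Real.exp (-(2 * K * R)) with hε
  have hε0 : 0 < ε := by positivity
  let η : EuclideanSpace ℝ (Fin n) → EuclideanSpace ℝ (Fin n) → ℝ :=
    fun x y => Real.exp (K * (x i0 + y i0))
  have hη0 : ∀ x y, 0 < η x y := fun x y => Real.exp_pos _
  have hηb : ∀ x ∈ Ω, ∀ y ∈ Ω, ε * η x y ≤ min (m / 2) (1 / K) := by
    intro x hx y hy
    have hp : 0 ≤ min (m / 2) (1 / K) := by positivity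
    rw [hε, mul_assoc, ← Real.exp_add]
    refine mul_le_of_le_one_right hp ?_
    rw [Real.exp_le_one_iff]
    have := (abs_le.1 (hR x hx)).2
    have := (abs_le.1 (hR y hy)).2
    nlinarith
  let Φ : EuclideanSpace ℝ (Fin n) → EuclideanSpace ℝ (Fin n) → ℝ :=
    fun x y => u x + u y - 2 * u ((1/2:ℝ) • (x + y)) + ε * η x y
  have hmemT : (x1, y1) ∈ T := by
    by_contra h
    have := hout x1 hx1 y1 hy1 h
    linarith
  have hΦc : ContinuousOn (fun p : EuclideanSpace ℝ (Fin n) × EuclideanSpace ℝ (Fin n) =>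
      Φ p.1 p.2) T := by
    have c1 : ContinuousOn (fun p : EuclideanSpace ℝ (Fin n) × EuclideanSpace ℝ (Fin n) =>
      u p.1) T := hucont.comp continuousOn_fst (fun p hp => (hTΩ hp).1)
    have c2 : ContinuousOn (fun p : EuclideanSpace ℝ (Fin n) × EuclideanSpace ℝ (Fin n) =>
      u p.2) T := hucont.comp continuousOn_snd (fun p hp => (hTΩ hp).2)
    have c3 := hucont.comp hzc hzm
    have c4 : ContinuousOn (fun p : EuclideanSpace ℝ (Fin n) × EuclideanSpace ℝ (Fin n) =>
      ε * η p.1 p.2) T := by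
      simp only [η]
      fun_prop
    exact ((c1.add c2).sub (continuousOn_const.mul c3)).add c4
  obtain ⟨⟨a, b⟩, hab, hmax⟩ := hT.exists_isMaxOn ⟨_, hmemT⟩ hΦc
  have ha : a ∈ Ω := (hTΩ hab).1
  have hb : b ∈ Ω := (hTΩ hab).2
  have hglob : ∀ x ∈ Ω, ∀ y ∈ Ω, Φ x y ≤ Φ a b := by
    intro x hx y hy
    by_cases h : (x, y) ∈ T
    · exact hmax h
    · have e1 := hout x hx y hy h
      have e2 := (hηb x hx y hy).trans (min_le_left _ _)
      have e3 : Φ x1 y1 ≤ Φ a b := hmax hmemT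
      have e4 := mul_pos hε0 (hη0 x1 y1)
      simp only [Φ] at e3 ⊢
      linarith
  set z := (1/2:ℝ) • (a + b) with hzdef
  have hzΩ : z ∈ Ω := hz a ha b hb
  have hCz : |fderiv ℝ u z (EuclideanSpace.single i0 1)| ≤ C := hC _ hab
  set N := η a b with hN
  have hexp : ∀ c : ℝ, ∀ t : ℝ, HasDerivAt (fun t : ℝ => ε * Real.exp (K * (a i0 + b i0 + t * c)))
      (ε * (Real.exp (K * (a i0 + b i0 + t * c)) * (K * c))) t := by
    intro c t
    have := ((((hasDerivAt_id t).mul_const c).const_add (a i0 + b i0)).const_mul K).exp.const_mul ε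
    simpa using this
  -- first-order conditions
  have fa : ∀ w, fderiv ℝ u a w = fderiv ℝ u z w - ε * K * N * w i0 := by
    intro w
    have hm : IsLocalMax (fun t : ℝ => u (a + t • w) + u b - 2 * u (z + t • ((1/2:ℝ) • w)) +
        ε * Real.exp (K * (a i0 + b i0 + t * w i0))) 0 := by
      filter_upwards [line_ev hΩ ha w] with t ht
      have := hglob _ ht b hb
      have e : (1/2:ℝ) • (a + t • w + b) = z + t • ((1/2:ℝ) • w) := by rw [hzdef]; module
      simp only [Φ, e, η] at this
      have e' : (a + t • w) i0 + b i0 = a i0 + b i0 + t * w i0 := by simp; ring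
      rw [e', ← hzdef] at this
      simpa using this
    have := hm.hasDerivAt_eq_zero ((((line1 hΩ hu a w 0 (by simpa using ha)).add_const (u b)).sub
      ((line1 hΩ hu z ((1/2:ℝ) • w) 0 (by simpa using hzΩ)).const_mul 2)).add (hexp (w i0) 0))
    simp only [zero_smul, add_zero, zero_mul, map_smul, smul_eq_mul] at this
    simp only [hN, η]
    linarith
  have fb : ∀ w, fderiv ℝ u b w = fderiv ℝ u z w - ε * K * N * w i0 := by
    intro w
    have hm : IsLocalMax (fun t : ℝ => u (b + t • w) + u a - 2 * u (z + t • ((1/2:ℝ) • w)) +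
        ε * Real.exp (K * (a i0 + b i0 + t * w i0))) 0 := by
      filter_upwards [line_ev hΩ hb w] with t ht
      have := hglob a ha _ ht
      have e : (1/2:ℝ) • (a + (b + t • w)) = z + t • ((1/2:ℝ) • w) := by rw [hzdef]; module
      simp only [Φ, e, η] at this
      have e' : a i0 + (b + t • w) i0 = a i0 + b i0 + t * w i0 := by simp; ring
      rw [e', add_comm (u a), add_comm (u a), ← hzdef] at this
      simpa using this
    have := hm.hasDerivAt_eq_zero ((((line1 hΩ hu b w 0 (by simpa using hb)).add_const (u a)).sub
      ((line1 hΩ hu z ((1/2:ℝ) • w) 0 (by simpa using hzΩ)).const_mul 2)).add (hexp (w i0) 0))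
    simp only [zero_smul, add_zero, zero_mul, map_smul, smul_eq_mul] at this
    simp only [hN, η]
    linarith
  -- second-order condition
  have sc : ∀ w : EuclideanSpace ℝ (Fin n), dd u a w + dd u b w - 2 * dd u z w +
      4 * (ε * K ^ 2 * N) * (w i0) ^ 2 ≤ 0 := by
    intro w
    have hm : IsLocalMax (fun t : ℝ => u (a + t • w) + u (b + t • w) - 2 * u (z + t • w) +
        ε * Real.exp (K * (a i0 + b i0 + t * (2 * w i0)))) 0 := by
      filter_upwards [line_ev hΩ ha w, line_ev hΩ hb w] with t ht ht'
      have := hglob _ ht _ ht'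
      have e : (1/2:ℝ) • (a + t • w + (b + t • w)) = z + t • w := by rw [hzdef]; module
      simp only [Φ, e, η] at this
      have e' : (a + t • w) i0 + (b + t • w) i0 = a i0 + b i0 + t * (2 * w i0) := by simp; ring
      rw [e', ← hzdef] at this
      simpa using this
    have := (second_test (by
        filter_upwards [line_ev hΩ ha w, line_ev hΩ hb w, line_ev hΩ hzΩ w] with t ha hb hz
        exact (((line1 hΩ hu a w t ha).add (line1 hΩ hu b w t hb)).sub
          ((line1 hΩ hu z w t hz).const_mul 2)).add (hexp (2 * w i0) t))
      ((((line2 hΩ hu a w 0 (by simpa using ha)).add (line2 hΩ hu b w 0 (by simpa using hb))).sub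
          ((line2 hΩ hu z w 0 (by simpa using hzΩ)).const_mul 2)).add
          (((hexp (2 * w i0) 0).mul_const (K * (2 * w i0))).congr_of_eventuallyEq
            (Eventually.of_forall fun t => by simp; ring))) hm).2
    simp only [zero_smul, add_zero, zero_mul] at this
    simp only [hN, η]
    linarith
  have hsum := Finset.sum_nonpos (s := Finset.univ)
    (fun (i : Fin n) _ => sc (EuclideanSpace.single i 1))
  simp only [Finset.sum_add_distrib, Finset.sum_sub_distrib, ← Finset.mul_sum, heq a ha, heq b hb,
    heq z hzΩ, fa, fb] at hsum
  have s1 : ∑ i : Fin n, ((EuclideanSpace.single i (1:ℝ)) i0) ^ 2 = 1 := by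
    simp [ite_pow]
  have s2 : ∀ c : ℝ, ∑ i : Fin n, (fderiv ℝ u z (EuclideanSpace.single i 1) -
      c * (EuclideanSpace.single i (1:ℝ)) i0) ^ 2 =
      ∑ i : Fin n, (fderiv ℝ u z (EuclideanSpace.single i 1)) ^ 2 -
      2 * c * fderiv ℝ u z (EuclideanSpace.single i0 1) + c ^ 2 := by
    intro c
    have : ∀ i : Fin n, (fderiv ℝ u z (EuclideanSpace.single i 1) -
      c * (EuclideanSpace.single i (1:ℝ)) i0) ^ 2 = (fderiv ℝ u z (EuclideanSpace.single i 1)) ^ 2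
      + if i0 = i then - 2 * c * fderiv ℝ u z (EuclideanSpace.single i 1) + c ^ 2 else 0 := by
      intro i
      by_cases h : i0 = i
      · subst h; simp; ring
      · simp [h]
    simp only [this, Finset.sum_add_distrib, Finset.sum_ite_eq, Finset.mem_univ, if_true]
    ring
  rw [s1, s2] at hsum
  have hqz := hq a ha b hb
  rw [← hzdef] at hqz
  set p := fderiv ℝ u z (EuclideanSpace.single i0 1)
  have hp : -C ≤ p := (abs_le.1 hCz).1
  have hNpos : 0 < N := hη0 a b
  have hsmall : ε * N * K ≤ 1 := by
    have := (hηb a ha b hb).trans (min_le_right _ _)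
    rwa [le_div_iff₀ (by linarith)] at this
  have key : (ε * K * N) * (4 * p - 2 * (ε * N * K) + 4 * K) ≤ 0 := by linarith
  have : 0 < (ε * K * N) * (4 * p - 2 * (ε * N * K) + 4 * K) := by
    apply mul_pos (by positivity)
    linarith
  linarith

section
variable {E : Type*} [NormedAddCommGroup E] [NormedSpace ℝ E]

theorem curve_derivs {ρ : E → ℝ} (hρ : ContDiff ℝ 2 ρ) (x0 w N : E) (a : ℝ) :
    (∀ t : ℝ, HasDerivAt (fun t : ℝ => ρ (x0 + t • w - (a * t ^ 2) • N))
      (fderiv ℝ ρ (x0 + t • w - (a * t ^ 2) • N) (w - (a * (2 * t)) • N)) t) ∧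
    HasDerivAt (fun t : ℝ => fderiv ℝ ρ (x0 + t • w - (a * t ^ 2) • N) (w - (a * (2 * t)) • N))
      (dd ρ x0 w - 2 * a * fderiv ℝ ρ x0 N) 0 := by
  have hγ : ∀ t : ℝ, HasDerivAt (fun t : ℝ => x0 + t • w - (a * t ^ 2) • N)
      (w - (a * (2 * t)) • N) t := by
    intro t
    have := (((hasDerivAt_id t).smul_const w).const_add x0).fun_sub
      ((((hasDerivAt_id t).pow 2).const_mul a).smul_const N)
    simpa using this
  have hd : ContDiff ℝ 1 (fderiv ℝ ρ) := hρ.fderiv_right (by norm_num)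
  constructor
  · intro t
    exact ((hρ.differentiable (by norm_num)) _).hasFDerivAt.comp_hasDerivAt t (hγ t)
  · have h1 : HasDerivAt (fun t : ℝ => fderiv ℝ ρ (x0 + t • w - (a * t ^ 2) • N))
      (fderiv ℝ (fderiv ℝ ρ) x0 w) 0 := by
      have hh : HasFDerivAt (fderiv ℝ ρ) (fderiv ℝ (fderiv ℝ ρ) x0)
          (x0 + (0:ℝ) • w - (a * 0 ^ 2) • N) := by
        simpa using ((hd.differentiable (by norm_num)) x0).hasFDerivAt
      exact (hh.comp_hasDerivAt 0 (hγ 0)).congr_deriv (by simp)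
    have h2 : HasDerivAt (fun t : ℝ => w - (a * (2 * t)) • N) (-((a * 2) • N)) 0 := by
      have := ((((hasDerivAt_id (0:ℝ)).const_mul 2).const_mul a).smul_const N).const_sub w
      simpa using this
    have h3 := h1.clm_apply h2
    refine h3.congr_deriv ?_
    have : dd ρ x0 w = fderiv ℝ (fderiv ℝ ρ) x0 w w := by
      unfold dd
      rw [fderiv_clm_apply ((hd.differentiable (by norm_num)) _) (differentiableAt_const _)]
      simp
    rw [this]
    simp
    ring

/-- Along a parabola-type curve staying on the boundary. -/
theorem exists_boundary_curve {ρ : E → ℝ} (hρ : ContDiff ℝ 2 ρ) {x0 w N : E} (h0 : ρ x0 = 0)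
    (hN : 0 < fderiv ℝ ρ x0 N) (hw : fderiv ℝ ρ x0 w = 0) (hD : 0 < dd ρ x0 w) :
    ∃ c C : ℝ, 0 < c ∧ ∃ a : ℝ → ℝ, ∀ᶠ t in 𝓝[≠] (0:ℝ),
      (c ≤ a t ∧ a t ≤ C) ∧ ρ (x0 + t • w - (a t * t ^ 2) • N) = 0 := by
  set g := fderiv ℝ ρ x0 N
  set D := dd ρ x0 w
  refine ⟨D / (4 * g), D / g, by positivity, ?_⟩
  have dpos : ∀ a : ℝ, deriv (deriv (fun t : ℝ => ρ (x0 + t • w - (a * t ^ 2) • N))) 0 = D - 2 * a * g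
      ∧ deriv (fun t : ℝ => ρ (x0 + t • w - (a * t ^ 2) • N)) 0 = 0 ∧
      ContinuousAt (fun t : ℝ => ρ (x0 + t • w - (a * t ^ 2) • N)) 0 := by
    intro a
    obtain ⟨h1, h2⟩ := curve_derivs hρ x0 w N a
    have e : deriv (fun t : ℝ => ρ (x0 + t • w - (a * t ^ 2) • N)) = _ := funext fun t => (h1 t).deriv
    refine ⟨?_, ?_, (h1 0).continuousAt⟩
    · rw [e]; exact h2.deriv
    · rw [(h1 0).deriv]; simpa using hw
  have m1 : IsLocalMin (fun t : ℝ => ρ (x0 + t • w - (D / (4 * g) * t ^ 2) • N)) 0 := by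
    obtain ⟨h1, h2, h3⟩ := dpos (D / (4 * g))
    refine isLocalMin_of_deriv_deriv_pos ?_ h2 h3
    rw [h1]
    have : D - 2 * (D / (4 * g)) * g = D / 2 := by field_simp; ring
    rw [this]; positivity
  have m2 : IsLocalMax (fun t : ℝ => ρ (x0 + t • w - (D / g * t ^ 2) • N)) 0 := by
    obtain ⟨h1, h2, h3⟩ := dpos (D / g)
    refine isLocalMax_of_deriv_deriv_neg ?_ h2 h3
    rw [h1]
    have : D - 2 * (D / g) * g = - D := by field_simp; ring
    rw [this]; linarith
  have : ∀ᶠ t in 𝓝[≠] (0:ℝ), ∃ a, (D / (4 * g) ≤ a ∧ a ≤ D / g) ∧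
      ρ (x0 + t • w - (a * t ^ 2) • N) = 0 := by
    refine nhdsWithin_le_nhds ?_
    filter_upwards [m1, m2] with t h1 h2
    simp only [zero_smul, add_zero, ne_eq, OfNat.ofNat_ne_zero, not_false_eq_true, zero_pow,
      mul_zero, sub_zero, h0] at h1 h2
    have hle : D / (4 * g) ≤ D / g := by
      apply div_le_div_of_nonneg_left hD.le hN; linarith
    have hcont : ContinuousOn (fun a : ℝ => ρ (x0 + t • w - (a * t ^ 2) • N)) (Icc (D / (4 * g)) (D / g)) := by
      have := hρ.continuous
      fun_prop
    obtain ⟨a, ha, ha'⟩ := intermediate_value_Icc' hle hcont (show (0:ℝ) ∈ _ from ⟨h2, h1⟩)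
    exact ⟨a, ⟨ha.1, ha.2⟩, ha'⟩
  exact this.choice

theorem seg_line1 {F : Type*} [NormedAddCommGroup F] [NormedSpace ℝ F] {φ : E → F}
    {P : E → E →L[ℝ] F} {S : Set E} {x0 h : E}
    (hPd : ∀ x ∈ S, HasFDerivWithinAt φ (P x) S x)
    (seg : ∀ s ∈ Icc (0:ℝ) 1, x0 + s • h ∈ S) {s : ℝ} (hs : s ∈ Icc (0:ℝ) 1) :
    HasDerivWithinAt (fun s : ℝ => φ (x0 + s • h)) (P (x0 + s • h) h) (Icc 0 1) s := by
  have h2 : HasDerivWithinAt (fun t : ℝ => x0 + t • h) h (Icc 0 1) s := by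
    simpa using (((hasDerivAt_id s).smul_const h).const_add x0).hasDerivWithinAt
  exact (hPd _ (seg s hs)).comp_hasDerivWithinAt s h2 (fun t ht => seg t ht)

theorem seg_line2 {P : E → E →L[ℝ] ℝ} {H : E → E →L[ℝ] E →L[ℝ] ℝ} {S : Set E} {x0 h : E}
    (hHd : ∀ x ∈ S, HasFDerivWithinAt P (H x) S x)
    (seg : ∀ s ∈ Icc (0:ℝ) 1, x0 + s • h ∈ S) {s : ℝ} (hs : s ∈ Icc (0:ℝ) 1) :
    HasDerivWithinAt (fun s : ℝ => P (x0 + s • h) h) (H (x0 + s • h) h h) (Icc 0 1) s := by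
  have h1 := seg_line1 hHd seg hs
  have h3 := h1.clm_apply (hasDerivWithinAt_const s _ h)
  exact h3.congr_deriv (by simp)

theorem tendsto_clm {F α : Type*} [NormedAddCommGroup F] [NormedSpace ℝ F] {l : Filter α}
    {f : α → E →L[ℝ] F} {g : α → E} {A : E →L[ℝ] F} {x : E} (hf : Tendsto f l (𝓝 A))
    (hg : Tendsto g l (𝓝 x)) : Tendsto (fun t => f t (g t)) l (𝓝 (A x)) := by
  have hc : Continuous (fun p : (E →L[ℝ] F) × E => p.1 p.2) := by fun_prop
  exact (hc.tendsto (A, x)).comp (hf.prodMk_nhds hg)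

theorem boundary_second {ρ φ : E → ℝ} {S : Set E} (hS : Convex ℝ S) (hSu : UniqueDiffOn ℝ S)
    (hφ : ContDiffOn ℝ 2 φ S) (hρ : ContDiff ℝ 2 ρ) (hz : ∀ x, ρ x = 0 → x ∈ S ∧ φ x = 0)
    {x0 w N : E} (h0 : ρ x0 = 0)
    (hN : 0 < fderiv ℝ ρ x0 N) (hw : fderiv ℝ ρ x0 w = 0) (hD : 0 < dd ρ x0 w)
    (hPN : fderivWithin ℝ φ S x0 N < 0) :
    fderivWithin ℝ φ S x0 w = 0 ∧
      fderivWithin ℝ (fderivWithin ℝ φ S) S x0 w w < 0 := by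
  obtain ⟨c, C, hc, a, ha⟩ := exists_boundary_curve hρ h0 hN hw hD
  set P := fderivWithin ℝ φ S with hP
  set H := fderivWithin ℝ P S with hH
  have hPc : ContDiffOn ℝ 1 P S := hφ.fderivWithin hSu (by norm_num)
  have hPcont : ContinuousOn P S := hPc.continuousOn
  have hHcont : ContinuousOn H S := hPc.continuousOn_fderivWithin hSu (by norm_num)
  have hx0 := hz x0 h0
  have hPd : ∀ x ∈ S, HasFDerivWithinAt φ (P x) S x := fun x hx =>
    ((hφ.differentiableOn (by norm_num)) x hx).hasFDerivWithinAt
  have hHd : ∀ x ∈ S, HasFDerivWithinAt P (H x) S x := fun x hx =>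
    ((hPc.differentiableOn (by norm_num)) x hx).hasFDerivWithinAt
  let k : ℝ → E := fun t => w - (a t * t) • N
  have seg : ∀ h : E, x0 + h ∈ S → ∀ s ∈ Icc (0:ℝ) 1, x0 + s • h ∈ S := fun h hh s hs =>
    hS.add_smul_mem hx0.1 hh hs
  have l1 : ∀ h : E, x0 + h ∈ S → ∀ s ∈ Icc (0:ℝ) 1,
      HasDerivWithinAt (fun s : ℝ => φ (x0 + s • h)) (P (x0 + s • h) h) (Icc 0 1) s :=
    fun h hh s hs => seg_line1 hPd (seg h hh) hs
  have l2 : ∀ h : E, x0 + h ∈ S → ∀ s ∈ Icc (0:ℝ) 1,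
      HasDerivWithinAt (fun s : ℝ => P (x0 + s • h) h) (H (x0 + s • h) h h) (Icc 0 1) s :=
    fun h hh s hs => seg_line2 hHd (seg h hh) hs
  have hk : ∀ t, x0 + t • w - (a t * t ^ 2) • N = x0 + t • k t := by
    intro t; simp only [k]; module
  have ex1 : ∀ᶠ t in 𝓝[≠] (0:ℝ), ∃ s : ℝ, s ∈ Icc (0:ℝ) 1 ∧ x0 + s • (t • k t) ∈ S ∧
      P (x0 + s • (t • k t)) (k t) = 0 := by
    filter_upwards [ha, self_mem_nhdsWithin] with t ht ht0
    rw [hk] at ht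
    have hh := (hz _ ht.2).1
    obtain ⟨s, hs, hs'⟩ := exists_hasDerivAt_eq_slope _ _ (zero_lt_one' ℝ)
      (fun s hs => (l1 _ hh s hs).continuousWithinAt)
      (fun s hs => (l1 _ hh s (Ioo_subset_Icc_self hs)).hasDerivAt (Icc_mem_nhds hs.1 hs.2))
    refine ⟨s, Ioo_subset_Icc_self hs, seg _ hh s (Ioo_subset_Icc_self hs), ?_⟩
    simp only [one_smul, zero_smul, add_zero, (hz _ ht.2).2, hx0.2] at hs'
    simpa [show t ≠ 0 from ht0] using hs'
  have hat : Tendsto (fun t => a t * t) (𝓝[≠] 0) (𝓝 0) := by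
    refine bdd_le_mul_tendsto_zero' (max |c| |C|) ?_ (tendsto_id.mono_left nhdsWithin_le_nhds)
    filter_upwards [ha] with t ht
    exact abs_le_max_abs_abs ht.1.1 ht.1.2
  have hkt : Tendsto k (𝓝[≠] 0) (𝓝 w) := by
    have := (tendsto_const_nhds (x := w)).sub (hat.smul_const N)
    simpa using this
  have hξ : ∀ s : ℝ → ℝ, (∀ᶠ t in 𝓝[≠] (0:ℝ), s t ∈ Icc (0:ℝ) 1) →
      Tendsto (fun t => x0 + s t • (t • k t)) (𝓝[≠] 0) (𝓝 x0) := by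
    intro s hs
    have h1 : Tendsto (fun t => s t * t) (𝓝[≠] 0) (𝓝 0) := by
      refine bdd_le_mul_tendsto_zero' 1 ?_ (tendsto_id.mono_left nhdsWithin_le_nhds)
      filter_upwards [hs] with t ht
      exact abs_le.2 ⟨by linarith [ht.1], ht.2⟩
    have := (tendsto_const_nhds (x := x0)).add (h1.smul hkt)
    simpa [mul_smul] using this
  have first : P x0 w = 0 := by
    obtain ⟨s, hs⟩ := ex1.choice
    have hx := hξ s (hs.mono fun t ht => ht.1)
    have h1 : Tendsto (fun t => P (x0 + s t • (t • k t))) (𝓝[≠] 0) (𝓝 (P x0)) :=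
      (hPcont x0 hx0.1).tendsto.comp (tendsto_nhdsWithin_iff.2 ⟨hx, hs.mono fun t ht => ht.2.1⟩)
    have h2 := tendsto_clm h1 hkt
    exact tendsto_nhds_unique h2 (tendsto_const_nhds.congr' (hs.mono fun t ht => ht.2.2.symm))
  refine ⟨first, ?_⟩
  have ex2 : ∀ᶠ t in 𝓝[≠] (0:ℝ), ∃ s : ℝ, s ∈ Icc (0:ℝ) 1 ∧ x0 + s • (t • k t) ∈ S ∧
      H (x0 + s • (t • k t)) (k t) (k t) ≤ 2 * c * P x0 N := by
    filter_upwards [ha, self_mem_nhdsWithin] with t ht ht0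
    rw [hk] at ht
    have hh := (hz _ ht.2).1
    obtain ⟨s, hs, hs'⟩ := taylor2 (l1 _ hh) (l2 _ hh)
    refine ⟨s, hs, seg _ hh s hs, ?_⟩
    simp only [one_smul, zero_smul, add_zero, (hz _ ht.2).2, hx0.2, map_smul,
      _root_.smul_apply, smul_eq_mul] at hs'
    have e : P x0 (k t) = - (a t * t) * P x0 N := by simp [k, first]
    rw [e] at hs'
    have ht2 : 0 < t ^ 2 := by have : t ≠ 0 := ht0; positivity
    have h3 : t ^ 2 * (H (x0 + s • (t • k t)) (k t) (k t)) = t ^ 2 * (2 * a t * P x0 N) := by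
      linarith
    have h4 := mul_left_cancel₀ ht2.ne' h3
    rw [h4]
    nlinarith [ht.1.1]
  obtain ⟨s, hs⟩ := ex2.choice
  have hx := hξ s (hs.mono fun t ht => ht.1)
  have h1 : Tendsto (fun t => H (x0 + s t • (t • k t))) (𝓝[≠] 0) (𝓝 (H x0)) :=
    (hHcont x0 hx0.1).tendsto.comp (tendsto_nhdsWithin_iff.2 ⟨hx, hs.mono fun t ht => ht.2.1⟩)
  have h2 := tendsto_clm (tendsto_clm h1 hkt) hkt
  have h3 := le_of_tendsto h2 (hs.mono fun t ht => ht.2.2)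
  have : 2 * c * P x0 N < 0 := mul_neg_of_pos_of_neg (by positivity) hPN
  linarith

/-- near a boundary point, `φ D²φ ≤ (Dφ)²`. -/
theorem near_boundary [FiniteDimensional ℝ E] {ρ φ : E → ℝ} {Ω S : Set E} (hΩ : IsOpen Ω)
    (hΩS : Ω ⊆ S) (hS : Convex ℝ S) (hSu : UniqueDiffOn ℝ S)
    (hφ : ContDiffOn ℝ 2 φ S) (hpos : ∀ x ∈ Ω, 0 < φ x)
    (hρ : ContDiff ℝ 2 ρ) (hz : ∀ x, ρ x = 0 → x ∈ S ∧ φ x = 0)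
    {x0 N : E} (h0 : ρ x0 = 0)
    (hN : 0 < fderiv ℝ ρ x0 N) (hD : ∀ w, w ≠ 0 → fderiv ℝ ρ x0 w = 0 → 0 < dd ρ x0 w)
    (hPN : fderivWithin ℝ φ S x0 N < 0) :
    ∀ᶠ x in 𝓝 x0, x ∈ Ω → ∀ w, φ x * dd φ x w ≤ (fderiv ℝ φ x w) ^ 2 := by
  set P := fderivWithin ℝ φ S with hP
  set H := fderivWithin ℝ P S with hH
  have hPc : ContDiffOn ℝ 1 P S := hφ.fderivWithin hSu (by norm_num)
  have hPcont : ContinuousOn P S := hPc.continuousOn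
  have hHcont : ContinuousOn H S := hPc.continuousOn_fderivWithin hSu (by norm_num)
  have hx0 := hz x0 h0
  have key : ∀ᶠ x in 𝓝 x0, ∀ w ∈ Metric.sphere (0:E) 1, x ∈ Ω → φ x * H x w w ≤ (P x w) ^ 2 := by
    refine (isCompact_sphere (0:E) 1).eventually_forall_of_forall_eventually ?_
    intro w hw
    have hw0 : w ≠ 0 := by rintro rfl; simp at hw
    suffices h : ∀ᶠ p : E × E in 𝓝[S] x0 ×ˢ 𝓝 w, p.1 ∈ Ω → φ p.1 * H p.1 p.2 p.2 ≤ (P p.1 p.2) ^ 2 by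
      have e : 𝓝[S] x0 ×ˢ 𝓝 w = 𝓝[S ×ˢ univ] (x0, w) := by
        rw [nhdsWithin_prod_eq, nhdsWithin_univ]
      rw [e, eventually_nhdsWithin_iff] at h
      filter_upwards [h] with p hp hpΩ
      exact hp ⟨hΩS hpΩ, mem_univ _⟩ hpΩ
    have tP : Tendsto (fun p : E × E => P p.1 p.2) (𝓝[S] x0 ×ˢ 𝓝 w) (𝓝 (P x0 w)) :=
      tendsto_clm ((hPcont x0 hx0.1).tendsto.comp tendsto_fst) tendsto_snd
    have tH : Tendsto (fun p : E × E => H p.1 p.2 p.2) (𝓝[S] x0 ×ˢ 𝓝 w) (𝓝 (H x0 w w)) :=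
      tendsto_clm (tendsto_clm ((hHcont x0 hx0.1).tendsto.comp tendsto_fst) tendsto_snd) tendsto_snd
    have tφ : Tendsto (fun p : E × E => φ p.1) (𝓝[S] x0 ×ˢ 𝓝 w) (𝓝 0) := by
      have := (hφ.continuousOn x0 hx0.1).tendsto.comp (tendsto_fst (f := 𝓝[S] x0) (g := 𝓝 w))
      rwa [hx0.2] at this
    by_cases hPw : P x0 w = 0
    · have hρw : fderiv ℝ ρ x0 w = 0 := by
        by_contra hne
        set s := fderiv ℝ ρ x0 w / fderiv ℝ ρ x0 N with hs
        have hs0 : s ≠ 0 := div_ne_zero hne hN.ne'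
        have ht : fderiv ℝ ρ x0 (w - s • N) = 0 := by
          simp [hs, hN.ne']
        have h1 : P x0 (w - s • N) = 0 := by
          by_cases h : w - s • N = 0
          · rw [h]; simp
          · exact (boundary_second hS hSu hφ hρ hz h0 hN ht (hD _ h ht) hPN).1
        simp [hPw, hs0] at h1
        exact hPN.ne h1
      have hneg := (boundary_second hS hSu hφ hρ hz h0 hN hρw (hD _ hw0 hρw) hPN).2
      filter_upwards [tH.eventually_lt_const hneg] with p hp hpΩ
      have := hpos _ hpΩ
      nlinarith [sq_nonneg (P p.1 p.2)]
    · have t1 := tφ.mul tH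
      have t2 := tP.pow 2
      rw [zero_mul] at t1
      have : 0 < (P x0 w) ^ 2 := by positivity
      filter_upwards [t1.eventually_lt t2 this] with p hp _ using hp.le
  filter_upwards [key] with x hx hxΩ w
  have eP : ∀ y ∈ Ω, P y = fderiv ℝ φ y := fun y hy =>
    fderivWithin_of_mem_nhds (mem_of_superset (hΩ.mem_nhds hy) hΩS)
  have eH : ∀ w, dd φ x w = H x w w := by
    intro w
    have hd : DifferentiableAt ℝ P x :=
      ((hPc.differentiableOn (by norm_num)) x (hΩS hxΩ)).differentiableAt
        (mem_of_superset (hΩ.mem_nhds hxΩ) hΩS)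
    have e1 : (fun y => fderiv ℝ φ y w) =ᶠ[𝓝 x] fun y => P y w := by
      filter_upwards [hΩ.mem_nhds hxΩ] with y hy
      rw [eP y hy]
    unfold dd
    rw [e1.fderiv_eq, hH, fderivWithin_of_mem_nhds (mem_of_superset (hΩ.mem_nhds hxΩ) hΩS),
      fderiv_clm_apply hd (differentiableAt_const _)]
    simp
  rw [eH, ← eP x hxΩ]
  by_cases hw : w = 0
  · simp [hw]
  have hn : ‖w‖ ≠ 0 := norm_ne_zero_iff.2 hw
  have := hx (‖w‖⁻¹ • w) (by simp [norm_smul, hn]) hxΩ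
  simp only [map_smul, _root_.smul_apply, smul_eq_mul] at this
  have hp : 0 < ‖w‖⁻¹ ^ 2 := by positivity
  have h2 : ‖w‖⁻¹ ^ 2 * (φ x * H x w w) ≤ ‖w‖⁻¹ ^ 2 * (P x w) ^ 2 := by linarith
  exact le_of_mul_le_mul_left h2 hp

end

theorem strict_mid {E : Type*} [NormedAddCommGroup E] [NormedSpace ℝ E] {ρ : E → ℝ}
    (hρ : ContDiff ℝ 2 ρ) (hc : Convex ℝ {x | ρ x ≤ 0})
    (hD : ∀ x, ρ x = 0 → ∀ w, w ≠ 0 → fderiv ℝ ρ x w = 0 → 0 < dd ρ x w)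
    {x y : E} (hx : ρ x ≤ 0) (hy : ρ y ≤ 0) (hne : x ≠ y) : ρ ((1/2:ℝ) • (x + y)) < 0 := by
  have hzle : ρ ((1/2:ℝ) • (x + y)) ≤ 0 := by
    have := hc hx hy (show (0:ℝ) ≤ 1/2 by norm_num) (show (0:ℝ) ≤ 1/2 by norm_num) (by norm_num)
    rw [smul_add]; exact this
  refine lt_of_le_of_ne hzle fun h0 => ?_
  set z := (1/2:ℝ) • (x + y) with hz
  have hm : IsLocalMax (fun t : ℝ => ρ (z + t • (y - x))) 0 := by
    filter_upwards [Icc_mem_nhds (show (-(1/2):ℝ) < 0 by norm_num) (show (0:ℝ) < 1/2 by norm_num)]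
      with t ht
    have e : z + t • (y - x) = (1/2 - t) • x + (1/2 + t) • y := by rw [hz]; module
    have := hc hx hy (show (0:ℝ) ≤ 1/2 - t by linarith [ht.2])
      (show (0:ℝ) ≤ 1/2 + t by linarith [ht.1]) (by ring)
    simp only [zero_smul, add_zero, h0, e]
    exact this
  have hu := hρ.contDiffOn (s := univ)
  have := second_test (Eventually.of_forall fun t => line1 isOpen_univ hu z (y - x) t (mem_univ _))
    (line2 isOpen_univ hu z (y - x) 0 (mem_univ _)) hm
  simp only [zero_smul, add_zero] at this
  have := hD z h0 (y - x) (sub_ne_zero.2 hne.symm) this.1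
  linarith

theorem stmt_4 {n : ℕ}
    (Ω : Set (EuclideanSpace ℝ (Fin n))) (ρ : EuclideanSpace ℝ (Fin n) → ℝ)
    (hΩ : IsOpen Ω) (hbd : Bornology.IsBounded Ω)
    (hρ : ContDiff ℝ 2 ρ)
    (hΩρ : Ω = {x | ρ x < 0})
    (hfr : frontier Ω = {x | ρ x = 0})
    (hν : ∀ x ∈ frontier Ω, gradient ρ x ≠ 0)
    (hsc : ∀ x ∈ frontier Ω, ∀ v : EuclideanSpace ℝ (Fin n), v ≠ 0 → ⟪gradient ρ x, v⟫ = 0 →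
      0 < fderiv ℝ (fun y => fderiv ℝ ρ y v) x v)
    (q : EuclideanSpace ℝ (Fin n) → ℝ)
    (hq : ConvexOn ℝ (closure Ω) q) (hqC : ContDiffOn ℝ 1 q (closure Ω))
    (φ₀ : EuclideanSpace ℝ (Fin n) → ℝ) (lam0 : ℝ)
    (hφC : ContDiffOn ℝ 2 φ₀ (closure Ω))
    (hφpos : ∀ x ∈ Ω, 0 < φ₀ x)
    (hφbd : ∀ x ∈ frontier Ω, φ₀ x = 0)
    (hφν : ∀ x ∈ frontier Ω, fderivWithin ℝ φ₀ (closure Ω) x (gradient ρ x) < 0)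
    (heig : ∀ x ∈ Ω, lap φ₀ x - q x * φ₀ x = -lam0 * φ₀ x)
 :
    ∀ x ∈ Ω, ∀ y ∈ Ω,
      ⟪gradient (fun z => Real.log (φ₀ z)) y - gradient (fun z => Real.log (φ₀ z)) x,
        y - x⟫ ≤ 0 := by
  intro x hx y hy
  rcases Nat.eq_zero_or_pos n with hn | hn
  · subst hn
    have : y - x = 0 := Subsingleton.elim _ _
    simp [this]
  have hcl : closure Ω = {x | ρ x ≤ 0} := by
    rw [closure_eq_self_union_frontier, hfr, hΩρ]
    ext z; simp [le_iff_lt_or_eq]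
  have hcS : Convex ℝ (closure Ω) := hq.1
  have hmemΩ : ∀ z, z ∈ Ω ↔ ρ z < 0 := fun z => by rw [hΩρ]; rfl
  have hmemS : ∀ z, z ∈ closure Ω ↔ ρ z ≤ 0 := fun z => by rw [hcl]; rfl
  have hmemF : ∀ z, z ∈ frontier Ω ↔ ρ z = 0 := fun z => by rw [hfr]; rfl
  have hD : ∀ x, ρ x = 0 → ∀ w, w ≠ 0 → fderiv ℝ ρ x w = 0 → 0 < dd ρ x w := by
    intro x hx w hw hw'
    refine hsc x ((hmemF x).2 hx) w hw ?_
    rw [inner_gradient_left]; exact hw'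
  have hsm : ∀ x y, ρ x ≤ 0 → ρ y ≤ 0 → x ≠ y → ρ ((1/2:ℝ) • (x + y)) < 0 :=
    fun x y hx hy hne => strict_mid hρ (hcl ▸ hcS) hD hx hy hne
  have hΩS : Ω ⊆ closure Ω := subset_closure
  have hintS : interior (closure Ω) = Ω := by
    refine subset_antisymm ?_ (interior_maximal subset_closure hΩ)
    intro z hz
    rw [hmemΩ]
    refine lt_of_le_of_ne ((hmemS z).1 (interior_subset hz)) fun h0 => ?_
    have hm : IsLocalMax ρ z := by
      filter_upwards [mem_interior_iff_mem_nhds.1 hz] with y hy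
      rw [h0]; exact (hmemS y).1 hy
    refine hν z ((hmemF z).2 h0) ?_
    unfold gradient
    rw [hm.fderiv_eq_zero]; simp
  have hcΩ : Convex ℝ Ω := hintS ▸ hcS.interior
  have hSu : UniqueDiffOn ℝ (closure Ω) := uniqueDiffOn_convex hcS (by rw [hintS]; exact ⟨x, hx⟩)
  have hφΩ : ContDiffOn ℝ 2 φ₀ Ω := hφC.mono hΩS
  set u : EuclideanSpace ℝ (Fin n) → ℝ := fun z => Real.log (φ₀ z) with hu
  have huC : ContDiffOn ℝ 2 u Ω := log_contDiffOn hφΩ hφpos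
  have hmidΩ : ∀ x ∈ Ω, ∀ y ∈ Ω, (1/2:ℝ) • (x + y) ∈ Ω := by
    intro x hx y hy
    have := hcΩ hx hy (show (0:ℝ) ≤ 1/2 by norm_num) (show (0:ℝ) ≤ 1/2 by norm_num) (by norm_num)
    rwa [smul_add]
  -- local concavity near the boundary
  have hloc : ∀ x0 ∈ frontier Ω, ∃ r > 0, ∀ x ∈ Ω ∩ Metric.ball x0 r, ∀ y ∈ Ω ∩ Metric.ball x0 r,
      u x + u y ≤ 2 * u ((1/2:ℝ) • (x + y)) := by
    intro x0 hx0
    have hN : 0 < fderiv ℝ ρ x0 (gradient ρ x0) := by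
      rw [← inner_gradient_left]
      exact real_inner_self_pos.2 (hν x0 hx0)
    have hev := near_boundary hΩ hΩS hcS hSu hφC hφpos hρ
      (fun x hx => ⟨(hmemS x).2 hx.le, hφbd x ((hmemF x).2 hx)⟩) ((hmemF x0).1 hx0) hN
      (hD x0 ((hmemF x0).1 hx0)) (hφν x0 hx0)
    obtain ⟨r, hr, hball⟩ := Metric.eventually_nhds_iff_ball.1 hev
    refine ⟨r, hr, fun x hx y hy => ?_⟩
    refine mid_of_dd (hΩ.inter Metric.isOpen_ball) (huC.mono inter_subset_left)
      (hcΩ.inter (convex_ball x0 r)) ?_ hx hy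
    intro z hz w
    have h1 := hball z hz.2 hz.1 w
    have hp := hφpos z hz.1
    rw [hu, log_dd hΩ hφΩ hφpos hz.1 w]
    have : dd φ₀ z w / φ₀ z - (fderiv ℝ φ₀ z w / φ₀ z) ^ 2 =
      (φ₀ z * dd φ₀ z w - (fderiv ℝ φ₀ z w) ^ 2) / (φ₀ z) ^ 2 := by field_simp
    rw [this]
    exact div_nonpos_of_nonpos_of_nonneg (by linarith) (by positivity)
  have heq : ∀ x ∈ Ω, ∑ i, dd u x (EuclideanSpace.single i 1) =
      q x - lam0 - ∑ i, (fderiv ℝ u x (EuclideanSpace.single i 1)) ^ 2 := by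
    intro x hx
    have hp := hφpos x hx
    simp only [hu, log_dd hΩ hφΩ hφpos hx, log_fderiv hΩ hφΩ hφpos hx, Finset.sum_sub_distrib,
      ← Finset.sum_div]
    have h1 : ∑ i, dd φ₀ x (EuclideanSpace.single i 1) = (q x - lam0) * φ₀ x := by
      have := heig x hx
      unfold lap at this
      unfold dd
      linarith
    rw [h1]
    field_simp
  obtain ⟨R, hR⟩ := hbd.exists_norm_le
  have hcomp : IsCompact (closure Ω) := hbd.isCompact_closure
  -- midpoint concavity
  have hmid : ∀ x ∈ Ω, ∀ y ∈ Ω, u x + u y ≤ 2 * u ((1/2:ℝ) • (x + y)) := by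
    by_contra! hcon
    obtain ⟨x1, hx1, y1, hy1, hlt⟩ := hcon
    set m := u x1 + u y1 - 2 * u ((1/2:ℝ) • (x1 + y1)) with hm
    have hm0 : 0 < m := by linarith
    choose! r hr hloc using hloc
    let U : Set (EuclideanSpace ℝ (Fin n) × EuclideanSpace ℝ (Fin n)) :=
      ⋃ x0 ∈ frontier Ω, Metric.ball x0 (r x0) ×ˢ Metric.ball x0 (r x0)
    have hU : IsOpen U := isOpen_biUnion fun x0 _ => Metric.isOpen_ball.prod Metric.isOpen_ball
    let G : EuclideanSpace ℝ (Fin n) × EuclideanSpace ℝ (Fin n) → ℝ :=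
      fun p => φ₀ p.1 * φ₀ p.2 - Real.exp (m / 2) * φ₀ ((1/2:ℝ) • (p.1 + p.2)) ^ 2
    have hmS : ∀ p ∈ closure Ω ×ˢ closure Ω, (1/2:ℝ) • (p.1 + p.2) ∈ closure Ω := by
      intro p hp
      have := hcS hp.1 hp.2 (show (0:ℝ) ≤ 1/2 by norm_num) (show (0:ℝ) ≤ 1/2 by norm_num)
        (by norm_num)
      rwa [smul_add]
    have hGc : ContinuousOn G (closure Ω ×ˢ closure Ω) := by
      have c0 := hφC.continuousOn
      have c1 := c0.comp (continuousOn_fst (s := closure Ω ×ˢ closure Ω)) (fun p hp => hp.1)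
      have c2 := c0.comp (continuousOn_snd (s := closure Ω ×ˢ closure Ω)) (fun p hp => hp.2)
      have c3 := c0.comp (f := fun p : EuclideanSpace ℝ (Fin n) × EuclideanSpace ℝ (Fin n) =>
        (1/2:ℝ) • (p.1 + p.2)) (s := closure Ω ×ˢ closure Ω) (by fun_prop) hmS
      exact (c1.mul c2).sub (continuousOn_const.mul (c3.pow 2))
    let T := ((closure Ω ×ˢ closure Ω) ∩ G ⁻¹' Ici 0) \ U
    have hT : IsCompact T :=
      (((hcomp.prod hcomp).of_isClosed_subset
        (hGc.preimage_isClosed_of_isClosed (isClosed_closure.prod isClosed_closure) isClosed_Ici)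
        inter_subset_left)).diff hU
    have hTΩ : T ⊆ Ω ×ˢ Ω := by
      rintro ⟨a, b⟩ ⟨⟨⟨ha, hb⟩, hG⟩, hnU⟩
      simp only at ha hb
      have ha' := (hmemS a).1 ha
      have hb' := (hmemS b).1 hb
      by_cases hab : a = b
      · subst hab
        have : ρ a ≠ 0 := by
          intro h0
          apply hnU
          have hf := (hmemF a).2 h0
          exact mem_biUnion hf ⟨Metric.mem_ball_self (hr a hf), Metric.mem_ball_self (hr a hf)⟩
        have := (hmemΩ a).2 (lt_of_le_of_ne ha' this)
        exact ⟨this, this⟩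
      · have hz := hφpos _ ((hmemΩ _).2 (hsm a b ha' hb' hab))
        have hpos : 0 < φ₀ a * φ₀ b := by
          have : 0 ≤ G (a, b) := hG
          simp only [G] at this
          have : 0 < Real.exp (m / 2) * φ₀ ((1/2:ℝ) • (a + b)) ^ 2 := by positivity
          linarith
        constructor
        · refine (hmemΩ a).2 (lt_of_le_of_ne ha' fun h0 => ?_)
          rw [hφbd a ((hmemF a).2 h0)] at hpos
          simp at hpos
        · refine (hmemΩ b).2 (lt_of_le_of_ne hb' fun h0 => ?_)
          rw [hφbd b ((hmemF b).2 h0)] at hpos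
          simp at hpos
    refine interior_max (R := R) hΩ hcΩ huC ?_ heq ⟨0, hn⟩ ?_ hT hTΩ hm0 hx1 hy1 hm.le ?_
    · intro a ha b hb
      have := hq.2 (hΩS ha) (hΩS hb) (show (0:ℝ) ≤ 1/2 by norm_num)
        (show (0:ℝ) ≤ 1/2 by norm_num) (by norm_num)
      rw [← smul_add] at this
      simp only [smul_eq_mul] at this
      linarith
    · intro a ha
      exact (PiLp.norm_apply_le a _).trans (hR a ha)
    · intro a ha b hb hab
      by_contra! hlt
      apply hab
      refine ⟨⟨⟨hΩS ha, hΩS hb⟩, ?_⟩, ?_⟩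
      · show 0 ≤ G (a, b)
        have pa := hφpos a ha
        have pb := hφpos b hb
        have pz := hφpos _ (hmidΩ a ha b hb)
        simp only [G]
        rw [sub_nonneg, ← Real.log_le_log_iff (by positivity) (by positivity),
          Real.log_mul (by positivity) (by positivity), Real.log_mul pa.ne' pb.ne',
          Real.log_exp, Real.log_pow]
        simp only [hu] at hlt
        push_cast
        linarith
      · intro hUab
        simp only [U, mem_iUnion] at hUab
        obtain ⟨x0, hx0, h1, h2⟩ := hUab
        have := hloc x0 hx0 a ⟨ha, h1⟩ b ⟨hb, h2⟩
        linarith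
  have hdd : ∀ x ∈ Ω, ∀ w, dd u x w ≤ 0 := fun x hx w => dd_of_mid hΩ huC hmid hx w
  have := mono_of_dd hΩ huC hcΩ hdd hx hy
  rw [inner_sub_left, inner_gradient_left, inner_gradient_left]
  linarith
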